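/- (Continuation step.) For α ∈ [0,1], define b^α = αb + (1-α)(-y), σ^α = ασ + (1-α)(-z), f^α = αf + (1-α)x, h^α = αh + (1-α)x, and consider the parameterized FBSΔE with extra free inhomogeneities (b₀, σ₀, f₀, h₀). If for some α₀ ∈ [0,1) the parameterized FBSΔE is uniquely solvable for all inhomogeneities, then there exists δ₀ ∈ (0,1), depending only on the Lipschitz constant c₁, the monotonicity constant c₂, and T, such that for all α ∈ [α₀, α₀+δ₀] the parameterized FBSΔE is uniquely solvable for all inhomogeneities. -/

import Mathlib

open Finset Matrix

section Setup

variable {Ω : Type*} [Fintype Ω] [DecidableEq Ω] {N : ℕ}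

/-- A probability on a finite sample space with everywhere-positive weights. -/
structure FinProb (Ω : Type*) [Fintype Ω] where
  p : Ω → ℝ
  pos : ∀ ω, 0 < p ω
  sum_one : ∑ ω, p ω = 1

/-- `ω` and `ω'` share the same `W`-path up to time `t` (the atoms of `F_t`). -/
def samePath (W : ℕ → Ω → Fin N) (t : ℕ) (ω ω' : Ω) : Prop :=
  ∀ s ∈ Finset.range (t + 1), W s ω = W s ω'

instance (W : ℕ → Ω → Fin N) (t : ℕ) (ω ω' : Ω) : Decidable (samePath W t ω ω') := by
  unfold samePath; infer_instance

/-- `F_t`-measurability: `f` is constant on the atoms of `F_t`. -/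
def measF (W : ℕ → Ω → Fin N) (t : ℕ) {α : Type*} (f : Ω → α) : Prop :=
  ∀ ω ω', samePath W t ω ω' → f ω = f ω'

/-- Conditional expectation given `F_t`. -/
noncomputable def cexp (P : FinProb Ω) (W : ℕ → Ω → Fin N) (t : ℕ)
    {E : Type*} [AddCommGroup E] [Module ℝ E] (Y : Ω → E) (ω : Ω) : E :=
  (∑ ω' ∈ univ.filter (fun ω' => samePath W t ω ω'), P.p ω')⁻¹ •
    ∑ ω' ∈ univ.filter (fun ω' => samePath W t ω ω'), P.p ω' • Y ω'

/-- The basis-vector valued process `W_t ∈ {e_1,…,e_N} ⊆ ℝ^N`. -/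
def wvec (W : ℕ → Ω → Fin N) (t : ℕ) (ω : Ω) : Fin N → ℝ :=
  fun j => if W t ω = j then 1 else 0

/-- `M_{t+1} = W_{t+1} - E[W_{t+1} | F_t]` (indexed so that `Mdiff P W t` is `M_{t+1}`). -/
noncomputable def Mdiff (P : FinProb Ω) (W : ℕ → Ω → Fin N) (t : ℕ) (ω : Ω) : Fin N → ℝ :=
  wvec W (t + 1) ω - cexp P W t (wvec W (t + 1)) ω

/-- One-step conditional transition probability `P_t^k = e_k^* E[W_{t+1}|F_t]`. -/
noncomputable def Pt (P : FinProb Ω) (W : ℕ → Ω → Fin N) (t : ℕ) (k : Fin N) (ω : Ω) : ℝ :=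
  cexp P W t (fun ω' => wvec W (t + 1) ω' k) ω

/-- The `N × (N-1)` matrix `Ĩ` whose top block is the identity and last row is all `-1`. -/
def Itil (n : ℕ) : Matrix (Fin (n + 1)) (Fin n) ℝ :=
  fun i j => if (i : ℕ) = (j : ℕ) then 1 else if (i : ℕ) = n then -1 else 0

end Setup


section NonlinearDefs

variable {Ω : Type*} [Fintype Ω] [DecidableEq Ω]

/-- `E[M_{t+1} M_{t+1}^* | F_t]`. -/
noncomputable def EMM {n : ℕ} (P : FinProb Ω) (W : ℕ → Ω → Fin (n + 1)) (t : ℕ) (ω : Ω) :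
    Matrix (Fin (n + 1)) (Fin (n + 1)) ℝ :=
  cexp P W t (fun ω' => Matrix.of fun i j => Mdiff P W t ω' i * Mdiff P W t ω' j) ω

/-- Euclidean norm of a finite real vector. -/
noncomputable def nr {m : ℕ} (v : Fin m → ℝ) : ℝ := Real.sqrt (∑ j, v j ^ 2)

/-- the row vector `z Ĩ`. -/
def zItil {n : ℕ} (z : Fin (n + 1) → ℝ) : Fin n → ℝ := Matrix.vecMul z (Itil n)

end NonlinearDefs

section ContinuationDefs

variable {Ω : Type*} [Fintype Ω] [DecidableEq Ω]

/-- `(X, Y, Z)` solves the parameterized FBSΔE with parameter `α` and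
inhomogeneities `(b0, σ0, f0, h0)`. -/
def IsSolP {n : ℕ} (P : FinProb Ω) (W : ℕ → Ω → Fin (n + 1)) (T : ℕ)
    (b f : ℕ → Ω → ℝ → ℝ → (Fin n → ℝ) → ℝ)
    (σ : ℕ → Ω → ℝ → ℝ → (Fin n → ℝ) → (Fin (n + 1) → ℝ))
    (h : Ω → ℝ → ℝ) (x0 : ℝ) (α : ℝ)
    (b0 f0 : ℕ → Ω → ℝ) (σ0 : ℕ → Ω → Fin (n + 1) → ℝ) (h0 : Ω → ℝ)
    (X Y : ℕ → Ω → ℝ) (Z : ℕ → Ω → Fin (n + 1) → ℝ) : Prop :=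
  (∀ t ≤ T, measF W t (X t)) ∧ (∀ t ≤ T, measF W t (Y t)) ∧ (∀ t < T, measF W t (Z t)) ∧
  (∀ t < T, ∀ ω, X (t + 1) ω - X t ω =
      (α * b t ω (X t ω) (Y t ω) (zItil (Z t ω)) + (1 - α) * (-(Y t ω))) + b0 t ω +
      dotProduct
        (fun j => α * σ t ω (X t ω) (Y t ω) (zItil (Z t ω)) j + (1 - α) * (-(Z t ω j)) +
          σ0 t ω j)
        (Mdiff P W t ω)) ∧
  (∀ t < T, ∀ ω, Y (t + 1) ω - Y t ω =
      -(α * f (t + 1) ω (X (t + 1) ω) (Y (t + 1) ω) (zItil (Z (t + 1) ω)) +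
          (1 - α) * X (t + 1) ω) - f0 (t + 1) ω +
      dotProduct (Z t ω) (Mdiff P W t ω)) ∧
  (∀ ω, X 0 ω = x0) ∧ (∀ ω, Y T ω = α * h ω (X T ω) + (1 - α) * X T ω + h0 ω)

/-- The parameterized FBSΔE with parameter `α` is uniquely solvable for all
adapted inhomogeneities. -/
def SolvableAt {n : ℕ} (P : FinProb Ω) (W : ℕ → Ω → Fin (n + 1)) (T : ℕ)
    (b f : ℕ → Ω → ℝ → ℝ → (Fin n → ℝ) → ℝ)
    (σ : ℕ → Ω → ℝ → ℝ → (Fin n → ℝ) → (Fin (n + 1) → ℝ))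
    (h : Ω → ℝ → ℝ) (x0 : ℝ) (α : ℝ) : Prop :=
  ∀ (b0 f0 : ℕ → Ω → ℝ) (σ0 : ℕ → Ω → Fin (n + 1) → ℝ) (h0 : Ω → ℝ),
    (∀ t, measF W t (b0 t)) → (∀ t, measF W t (f0 t)) → (∀ t, measF W t (σ0 t)) →
    measF W T h0 →
    ∃ (X Y : ℕ → Ω → ℝ) (Z : ℕ → Ω → Fin (n + 1) → ℝ),
      IsSolP P W T b f σ h x0 α b0 f0 σ0 h0 X Y Z ∧
      ∀ (X' Y' : ℕ → Ω → ℝ) (Z' : ℕ → Ω → Fin (n + 1) → ℝ),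
        IsSolP P W T b f σ h x0 α b0 f0 σ0 h0 X' Y' Z' →
        (∀ t ≤ T, ∀ ω, X' t ω = X t ω ∧ Y' t ω = Y t ω) ∧
        (∀ t < T, ∀ ω, dotProduct (Z' t ω) (Mdiff P W t ω) =
            dotProduct (Z t ω) (Mdiff P W t ω))

end ContinuationDefs

section Helpers

set_option linter.unusedSectionVars false

variable {Ω : Type} [Fintype Ω] [DecidableEq Ω]

lemma sp_refl {N : ℕ} (W : ℕ → Ω → Fin N) (t : ℕ) (ω : Ω) : samePath W t ω ω := fun _ _ => rfl

lemma sp_symm {N : ℕ} {W : ℕ → Ω → Fin N} {t : ℕ} {ω ω' : Ω} (h : samePath W t ω ω') :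
    samePath W t ω' ω := fun s hs => (h s hs).symm

lemma sp_trans {N : ℕ} {W : ℕ → Ω → Fin N} {t : ℕ} {ω ω' ω'' : Ω} (h : samePath W t ω ω')
    (h' : samePath W t ω' ω'') : samePath W t ω ω'' := fun s hs => (h s hs).trans (h' s hs)

lemma sp_filter {N : ℕ} {W : ℕ → Ω → Fin N} {t : ℕ} {ω ω' : Ω} (h : samePath W t ω ω') :
    univ.filter (fun x => samePath W t ω x) = univ.filter (fun x => samePath W t ω' x) := by
  ext x
  simp only [mem_filter, mem_univ, true_and]
  exact ⟨fun h1 => sp_trans (sp_symm h) h1, fun h1 => sp_trans h h1⟩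

/-- mass of the atom -/
noncomputable def Dm {N : ℕ} (P : FinProb Ω) (W : ℕ → Ω → Fin N) (t : ℕ) (ω : Ω) : ℝ :=
  ∑ ω' ∈ univ.filter (fun ω' => samePath W t ω ω'), P.p ω'

lemma Dm_pos {N : ℕ} (P : FinProb Ω) (W : ℕ → Ω → Fin N) (t : ℕ) (ω : Ω) : 0 < Dm P W t ω := by
  unfold Dm
  apply Finset.sum_pos (fun i _ => P.pos i)
  exact ⟨ω, by simp [sp_refl]⟩

lemma Dm_le {N : ℕ} (P : FinProb Ω) (W : ℕ → Ω → Fin N) (t : ℕ) (ω : Ω) : Dm P W t ω ≤ 1 := by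
  unfold Dm
  rw [← P.sum_one]
  exact Finset.sum_le_sum_of_subset_of_nonneg (Finset.filter_subset _ _)
    (fun i _ _ => (P.pos i).le)

lemma Dm_congr {N : ℕ} (P : FinProb Ω) {W : ℕ → Ω → Fin N} {t : ℕ} {ω ω' : Ω}
    (h : samePath W t ω ω') : Dm P W t ω = Dm P W t ω' := by
  unfold Dm
  rw [sp_filter h]

lemma cexp_real {N : ℕ} (P : FinProb Ω) (W : ℕ → Ω → Fin N) (t : ℕ) (Y : Ω → ℝ) (ω : Ω) :
    cexp P W t Y ω = (Dm P W t ω)⁻¹ *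
      ∑ ω' ∈ univ.filter (fun ω' => samePath W t ω ω'), P.p ω' * Y ω' := rfl

lemma cexp_congr {N : ℕ} (P : FinProb Ω) {W : ℕ → Ω → Fin N} {t : ℕ} {E : Type*}
    [AddCommGroup E] [Module ℝ E] (Y : Ω → E) {ω ω' : Ω}
    (h : samePath W t ω ω') : cexp P W t Y ω = cexp P W t Y ω' := by
  unfold cexp
  rw [sp_filter h]

lemma cexp_const {N : ℕ} (P : FinProb Ω) (W : ℕ → Ω → Fin N) (t : ℕ) (c : ℝ) (ω : Ω) :
    cexp P W t (fun _ => c) ω = c := by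
  rw [cexp_real, ← Finset.sum_mul]
  change (Dm P W t ω)⁻¹ * (Dm P W t ω * c) = c
  have := (Dm_pos P W t ω).ne'
  field_simp

lemma cexp_ext {N : ℕ} (P : FinProb Ω) (W : ℕ → Ω → Fin N) (t : ℕ) (Y Y' : Ω → ℝ) (ω : Ω)
    (h : ∀ ω', samePath W t ω ω' → Y ω' = Y' ω') : cexp P W t Y ω = cexp P W t Y' ω := by
  rw [cexp_real, cexp_real]
  congr 1
  apply Finset.sum_congr rfl
  intro x hx
  rw [h x (by simpa using hx)]

lemma cexp_mono {N : ℕ} (P : FinProb Ω) (W : ℕ → Ω → Fin N) (t : ℕ) (Y Y' : Ω → ℝ) (ω : Ω)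
    (h : ∀ ω', samePath W t ω ω' → Y ω' ≤ Y' ω') : cexp P W t Y ω ≤ cexp P W t Y' ω := by
  rw [cexp_real, cexp_real]
  apply mul_le_mul_of_nonneg_left _ (inv_nonneg.2 (Dm_pos P W t ω).le)
  apply Finset.sum_le_sum
  intro x hx
  exact mul_le_mul_of_nonneg_left (h x (by simpa using hx)) (P.pos x).le

lemma cexp_add {N : ℕ} (P : FinProb Ω) (W : ℕ → Ω → Fin N) (t : ℕ) (Y Y' : Ω → ℝ) (ω : Ω) :
    cexp P W t (fun x => Y x + Y' x) ω = cexp P W t Y ω + cexp P W t Y' ω := by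
  simp only [cexp_real, mul_add, Finset.sum_add_distrib]

lemma cexp_smul {N : ℕ} (P : FinProb Ω) (W : ℕ → Ω → Fin N) (t : ℕ) (Y : Ω → ℝ) (c : ℝ) (ω : Ω) :
    cexp P W t (fun x => c * Y x) ω = c * cexp P W t Y ω := by
  simp only [cexp_real, Finset.mul_sum]
  apply Finset.sum_congr rfl
  intros
  ring

lemma cexp_sum {N : ℕ} {ι : Type*} (s : Finset ι) (P : FinProb Ω) (W : ℕ → Ω → Fin N) (t : ℕ)
    (Y : ι → Ω → ℝ) (ω : Ω) :
    cexp P W t (fun x => ∑ i ∈ s, Y i x) ω = ∑ i ∈ s, cexp P W t (Y i) ω := by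
  simp only [cexp_real, Finset.mul_sum]
  rw [Finset.sum_comm]

/-- tower property, diagonal version -/
lemma tower {N : ℕ} (P : FinProb Ω) (W : ℕ → Ω → Fin N) (t : ℕ) (G : Ω → Ω → ℝ)
    (hG : ∀ ω ω', samePath W t ω ω' → G ω = G ω') :
    ∑ ω, P.p ω * cexp P W t (G ω) ω = ∑ ω, P.p ω * G ω ω := by
  simp only [cexp_real, Finset.sum_filter, Finset.mul_sum]
  rw [Finset.sum_comm]
  apply Finset.sum_congr rfl
  intro x _
  have h1 : ∀ i, P.p i * ((Dm P W t i)⁻¹ * if samePath W t i x then P.p x * G i x else 0) =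
      (if samePath W t x i then P.p i else 0) * ((Dm P W t x)⁻¹ * (P.p x * G x x)) := by
    intro i
    by_cases h : samePath W t i x
    · rw [if_pos h, if_pos (sp_symm h), hG i x h, Dm_congr P h]
    · rw [if_neg h, if_neg (fun h' => h (sp_symm h'))]
      ring
  simp only [h1]
  rw [← Finset.sum_mul, ← Finset.sum_filter]
  change Dm P W t x * _ = _
  have := (Dm_pos P W t x).ne'
  field_simp

variable {n : ℕ}

lemma cexp_pi (P : FinProb Ω) (W : ℕ → Ω → Fin (n+1)) (t : ℕ) (Y : Ω → Fin (n+1) → ℝ) (ω : Ω)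
    (k : Fin (n+1)) : cexp P W t Y ω k = cexp P W t (fun x => Y x k) ω := by
  unfold cexp
  simp [Finset.sum_apply]

lemma EMM_apply (P : FinProb Ω) (W : ℕ → Ω → Fin (n+1)) (t : ℕ) (ω : Ω) (i j : Fin (n+1)) :
    EMM P W t ω i j = cexp P W t (fun x => Mdiff P W t x i * Mdiff P W t x j) ω := by
  unfold EMM cexp
  simp [Matrix.smul_apply, Matrix.sum_apply]

lemma EMM_congr (P : FinProb Ω) {W : ℕ → Ω → Fin (n+1)} {t : ℕ} {ω ω' : Ω}
    (h : samePath W t ω ω') : EMM P W t ω = EMM P W t ω' := by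
  unfold EMM
  exact cexp_congr P _ h

/-- the bilinear form `s E[MM*] z` -/
noncomputable def qf (P : FinProb Ω) (W : ℕ → Ω → Fin (n+1)) (t : ℕ) (ω : Ω)
    (s z : Fin (n+1) → ℝ) : ℝ := dotProduct (Matrix.vecMul s (EMM P W t ω)) z

lemma qf_eq (P : FinProb Ω) (W : ℕ → Ω → Fin (n+1)) (t : ℕ) (ω : Ω) (s z : Fin (n+1) → ℝ) :
    qf P W t ω s z = cexp P W t
      (fun x => dotProduct s (Mdiff P W t x) * dotProduct z (Mdiff P W t x)) ω := by
  have h : (fun x => dotProduct s (Mdiff P W t x) * dotProduct z (Mdiff P W t x)) =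
      fun x => ∑ j, ∑ i, (s i * z j) * (Mdiff P W t x i * Mdiff P W t x j) := by
    funext x
    simp only [dotProduct, Finset.sum_mul_sum]
    rw [Finset.sum_comm]
    apply Finset.sum_congr rfl
    intros
    apply Finset.sum_congr rfl
    intros
    ring
  rw [h, cexp_sum]
  simp only [cexp_sum, cexp_smul, ← EMM_apply]
  simp only [qf, dotProduct, Matrix.vecMul, Finset.sum_mul]
  apply Finset.sum_congr rfl
  intros
  apply Finset.sum_congr rfl
  intros
  ring

lemma M_sum (P : FinProb Ω) (W : ℕ → Ω → Fin (n+1)) (t : ℕ) (ω : Ω) :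
    ∑ j, Mdiff P W t ω j = 0 := by
  have h1 : ∀ x, ∑ j, wvec W (t+1) x j = 1 := by
    intro x
    simp [wvec]
  simp only [Mdiff, Pi.sub_apply, Finset.sum_sub_distrib, h1, cexp_pi]
  rw [← cexp_sum]
  simp only [h1, cexp_const, sub_self]

lemma zItil_apply (z : Fin (n+1) → ℝ) (k : Fin n) :
    zItil z k = z k.castSucc - z (Fin.last n) := by
  simp only [zItil, Matrix.vecMul, dotProduct, Itil]
  rw [Fin.sum_univ_castSucc]
  have h1 : ∀ i : Fin n, z i.castSucc * (if ((i.castSucc : Fin (n+1)) : ℕ) = (k : ℕ) then (1:ℝ) else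
      if ((i.castSucc : Fin (n+1)) : ℕ) = n then -1 else 0) = if i = k then z k.castSucc else 0 := by
    intro i
    have hi := i.isLt
    by_cases h : i = k
    · subst h; simp
    · have : (i : ℕ) ≠ k := fun h' => h (Fin.ext h')
      simp [h, this, hi.ne]
  simp only [h1]
  have hk := k.isLt
  simp [hk.ne']
  ring

lemma zItil_sub (z z' : Fin (n+1) → ℝ) : zItil (z - z') = zItil z - zItil z' := by
  funext k
  simp only [zItil_apply, Pi.sub_apply]
  ring

/-- dot product with `M` only depends on `zItil` -/
lemma dot_M_congr (P : FinProb Ω) (W : ℕ → Ω → Fin (n+1)) (t : ℕ) (ω : Ω)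
    (z z' : Fin (n+1) → ℝ) (h : zItil z = zItil z') :
    dotProduct z (Mdiff P W t ω) = dotProduct z' (Mdiff P W t ω) := by
  have h1 : ∀ j, z j = z' j + (z (Fin.last n) - z' (Fin.last n)) := by
    intro j
    induction j using Fin.lastCases with
    | last => ring
    | cast k =>
      have := congrFun h k
      simp only [zItil_apply] at this
      linarith
  have h2 : dotProduct z (Mdiff P W t ω) = ∑ j, (z' j * Mdiff P W t ω j +
      (z (Fin.last n) - z' (Fin.last n)) * Mdiff P W t ω j) := by
    apply Finset.sum_congr rfl
    intro j _
    rw [h1 j]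
    ring
  rw [h2, Finset.sum_add_distrib, ← Finset.mul_sum, M_sum]
  simp [dotProduct]

/-- normalisation -/
def nz (v : Fin n → ℝ) : Fin (n+1) → ℝ := Fin.snoc v 0

lemma zItil_nz (v : Fin n → ℝ) : zItil (nz v) = v := by
  funext k
  simp [zItil_apply, nz]

lemma dot_M (P : FinProb Ω) (W : ℕ → Ω → Fin (n+1)) (t : ℕ) (ω : Ω) (s : Fin (n+1) → ℝ) :
    dotProduct s (Mdiff P W t ω) = s (W (t+1) ω) - cexp P W t (fun x => s (W (t+1) x)) ω := by
  have h1 : ∀ x, s (W (t+1) x) = ∑ j, s j * wvec W (t+1) x j := by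
    intro x
    simp [wvec]
  simp only [h1]
  rw [cexp_sum]
  simp only [cexp_smul, ← cexp_pi P W t (wvec W (t+1)), dotProduct, Mdiff, Pi.sub_apply, mul_sub,
    Finset.sum_sub_distrib]

lemma M_zero (P : FinProb Ω) (W : ℕ → Ω → Fin (n+1)) (t : ℕ) (ω : Ω) (s : Fin (n+1) → ℝ) :
    cexp P W t (fun x => dotProduct s (Mdiff P W t x)) ω = 0 := by
  rw [cexp_ext P W t _ (fun x => s (W (t+1) x) + (-1) * cexp P W t (fun x => s (W (t+1) x)) ω),
    cexp_add, cexp_const]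
  · ring
  · intro x hx
    rw [dot_M, cexp_congr P _ hx]
    ring

lemma qf_nonneg (P : FinProb Ω) (W : ℕ → Ω → Fin (n+1)) (t : ℕ) (ω : Ω) (s : Fin (n+1) → ℝ) :
    0 ≤ qf P W t ω s s := by
  rw [qf_eq, ← cexp_const P W t 0 ω]
  apply cexp_mono
  intro x _
  exact mul_self_nonneg _

lemma qf_young (P : FinProb Ω) (W : ℕ → Ω → Fin (n+1)) (t : ℕ) (ω : Ω) (s z : Fin (n+1) → ℝ)
    (κ : ℝ) (hκ : 0 < κ) :
    qf P W t ω s z ≤ κ/2 * qf P W t ω z z + 1/(2*κ) * qf P W t ω s s := by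
  simp only [qf_eq]
  rw [← cexp_smul, ← cexp_smul, ← cexp_add]
  apply cexp_mono
  intro x _
  generalize dotProduct s (Mdiff P W t x) = a
  generalize dotProduct z (Mdiff P W t x) = c
  have : κ/2*(c*c) + 1/(2*κ)*(a*a) - a*c = (κ*c-a)^2/(2*κ) := by field_simp; ring
  have h2 : 0 ≤ (κ*c-a)^2/(2*κ) := by positivity
  linarith

lemma nr_sq {m : ℕ} (v : Fin m → ℝ) : nr v ^ 2 = ∑ j, v j ^ 2 :=
  Real.sq_sqrt (Finset.sum_nonneg fun _ _ => sq_nonneg _)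

lemma nr_nonneg {m : ℕ} (v : Fin m → ℝ) : 0 ≤ nr v := Real.sqrt_nonneg _

lemma qf_le (P : FinProb Ω) (W : ℕ → Ω → Fin (n+1)) (t : ℕ) (ω : Ω) (s : Fin (n+1) → ℝ) :
    qf P W t ω s s ≤ nr (zItil s) ^ 2 := by
  set s' := nz (zItil s) with hs'
  have hd : ∀ x, dotProduct s (Mdiff P W t x) = dotProduct s' (Mdiff P W t x) := by
    intro x
    apply dot_M_congr
    rw [hs', zItil_nz]
  set c := cexp P W t (fun x => s' (W (t+1) x)) ω with hc
  have h1 : qf P W t ω s s = cexp P W t (fun x => s' (W (t+1) x) ^ 2) ω - c^2 := by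
    rw [qf_eq, cexp_ext P W t _ (fun x => s' (W (t+1) x)^2 + ((-2*c) * s' (W (t+1) x) + c^2)),
      cexp_add, cexp_add, cexp_smul, cexp_const, ← hc]
    · ring
    · intro x hx
      rw [hd, dot_M, ← cexp_congr P _ hx, ← hc]
      ring
  have h2 : cexp P W t (fun x => s' (W (t+1) x) ^ 2) ω ≤ nr (zItil s) ^ 2 := by
    rw [← cexp_const P W t (nr (zItil s) ^ 2) ω]
    apply cexp_mono
    intro x _
    rw [nr_sq]
    generalize W (t+1) x = j
    induction j using Fin.lastCases with
    | last =>
      simp only [hs', nz, Fin.snoc_last]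
      have : 0 ≤ ∑ j, zItil s j ^ 2 := Finset.sum_nonneg fun _ _ => sq_nonneg _
      simpa using this
    | cast k =>
      simp only [hs', nz, Fin.snoc_castSucc]
      exact Finset.single_le_sum (f := fun j => zItil s j ^ 2) (fun _ _ => sq_nonneg _)
        (Finset.mem_univ k)
  nlinarith [sq_nonneg c]

lemma exists_succ (P : FinProb Ω) (W : ℕ → Ω → Fin (n+1)) (t : ℕ) (ω : Ω) (k : Fin (n+1))
    (h : 0 < Pt P W t k ω) : ∃ x, samePath W t ω x ∧ W (t+1) x = k := by
  by_contra hcon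
  push Not at hcon
  unfold Pt at h
  rw [cexp_ext P W t _ (fun _ => 0), cexp_const] at h
  · exact lt_irrefl _ h
  · intro x hx
    simp [wvec, hcon x hx]

lemma qf_ge_pt (P : FinProb Ω) (W : ℕ → Ω → Fin (n+1)) (t : ℕ) (ω x : Ω) (s : Fin (n+1) → ℝ)
    (hx : samePath W t ω x) (m : ℝ) (hm : m ≤ P.p x) :
    m * (dotProduct s (Mdiff P W t x))^2 ≤ qf P W t ω s s := by
  rw [qf_eq, cexp_real]
  have hD := Dm_pos P W t ω
  have hD1 := Dm_le P W t ω
  have h1 : P.p x * (dotProduct s (Mdiff P W t x))^2 ≤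
      ∑ ω' ∈ univ.filter (fun ω' => samePath W t ω ω'),
        P.p ω' * (dotProduct s (Mdiff P W t ω') * dotProduct s (Mdiff P W t ω')) := by
    have := Finset.single_le_sum (s := univ.filter (fun ω' => samePath W t ω ω'))
      (f := fun ω' => P.p ω' * (dotProduct s (Mdiff P W t ω') * dotProduct s (Mdiff P W t ω')))
      (fun i _ => mul_nonneg (P.pos i).le (mul_self_nonneg _)) (a := x) (by simpa using hx)
    rw [pow_two]
    exact this
  have h2 : m * (dotProduct s (Mdiff P W t x))^2 ≤ P.p x * (dotProduct s (Mdiff P W t x))^2 :=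
    mul_le_mul_of_nonneg_right hm (sq_nonneg _)
  have h3 : 1 ≤ (Dm P W t ω)⁻¹ := (one_le_inv₀ hD).2 hD1
  have h4 : 0 ≤ P.p x * (dotProduct s (Mdiff P W t x))^2 := mul_nonneg (P.pos x).le (sq_nonneg _)
  nlinarith

lemma qf_ge (P : FinProb Ω) (W : ℕ → Ω → Fin (n+1)) (t : ℕ) (ω : Ω) (s : Fin (n+1) → ℝ)
    (hP : ∀ k, 0 < Pt P W t k ω) (m : ℝ) (hm0 : 0 < m) (hm : ∀ x, m ≤ P.p x) :
    nr (zItil s) ^ 2 ≤ (4 * n / m) * qf P W t ω s s := by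
  rw [nr_sq]
  have h : ∀ k : Fin n, zItil s k ^ 2 ≤ (4 / m) * qf P W t ω s s := by
    intro k
    obtain ⟨x, hx, hxk⟩ := exists_succ P W t ω k.castSucc (hP _)
    obtain ⟨y, hy, hyk⟩ := exists_succ P W t ω (Fin.last n) (hP _)
    have h1 := qf_ge_pt P W t ω x s hx m (hm x)
    have h2 := qf_ge_pt P W t ω y s hy m (hm y)
    have h3 : zItil s k = dotProduct s (Mdiff P W t x) - dotProduct s (Mdiff P W t y) := by
      rw [zItil_apply, dot_M, dot_M, hxk, hyk, ← cexp_congr P _ hx, ← cexp_congr P _ hy]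
      ring
    rw [h3, div_mul_eq_mul_div, le_div_iff₀ hm0]
    nlinarith [sq_nonneg (dotProduct s (Mdiff P W t x) + dotProduct s (Mdiff P W t y))]
  calc ∑ j, zItil s j ^ 2 ≤ ∑ _j : Fin n, (4 / m) * qf P W t ω s s :=
        Finset.sum_le_sum fun k _ => h k
    _ = _ := by simp; ring

lemma dot_le_nr {m : ℕ} (u v : Fin m → ℝ) : dotProduct u v ≤ nr u * nr v := by
  unfold nr
  exact Real.sum_mul_le_sqrt_mul_sqrt _ _ _

/-- pointwise control of `zItil s` by `s E[MM*]` -/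
lemma nr_le_EMM (P : FinProb Ω) (W : ℕ → Ω → Fin (n+1)) (t : ℕ) (ω : Ω) (s : Fin (n+1) → ℝ)
    (hP : ∀ k, 0 < Pt P W t k ω) (m : ℝ) (hm0 : 0 < m) (hm : ∀ x, m ≤ P.p x) :
    nr (zItil s) ≤ (4 * n / m) * nr (Matrix.vecMul s (EMM P W t ω)) := by
  have h1 := qf_ge P W t ω s hP m hm0 hm
  have h2 : qf P W t ω s s = qf P W t ω s (nz (zItil s)) := by
    rw [qf_eq, qf_eq]
    congr 1
    funext x
    rw [dot_M_congr P W t x s (nz (zItil s)) (by rw [zItil_nz])]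
  have h3 : nr (nz (zItil s)) = nr (zItil s) := by
    unfold nr
    rw [Fin.sum_univ_castSucc]
    simp [nz]
  have h4 : qf P W t ω s s ≤ nr (Matrix.vecMul s (EMM P W t ω)) * nr (zItil s) := by
    rw [h2, ← h3]
    exact dot_le_nr _ _
  have hc : 0 ≤ 4 * (n:ℝ) / m := by positivity
  rcases (nr_nonneg (zItil s)).eq_or_lt with h0 | h0
  · rw [← h0]
    exact mul_nonneg hc (nr_nonneg _)
  · have h5 := mul_le_mul_of_nonneg_left h4 hc
    have h6 : nr (zItil s) * nr (zItil s) ≤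
      ((4 * n / m) * nr (Matrix.vecMul s (EMM P W t ω))) * nr (zItil s) := by nlinarith
    exact le_of_mul_le_mul_right h6 h0

lemma E_gM (P : FinProb Ω) (W : ℕ → Ω → Fin (n+1)) (t : ℕ) (g : Ω → ℝ) (s : Ω → Fin (n+1) → ℝ)
    (hg : measF W t g) (hs : measF W t s) :
    ∑ ω, P.p ω * (g ω * dotProduct (s ω) (Mdiff P W t ω)) = 0 := by
  rw [← tower P W t (fun ω x => g ω * dotProduct (s ω) (Mdiff P W t x))]
  · simp only [cexp_smul, M_zero, mul_zero, Finset.sum_const_zero]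
  · intro x y h
    funext w
    rw [hg x y h, hs x y h]

lemma E_MM (P : FinProb Ω) (W : ℕ → Ω → Fin (n+1)) (t : ℕ) (s z : Ω → Fin (n+1) → ℝ)
    (hs : measF W t s) (hz : measF W t z) :
    ∑ ω, P.p ω * (dotProduct (s ω) (Mdiff P W t ω) * dotProduct (z ω) (Mdiff P W t ω)) =
      ∑ ω, P.p ω * qf P W t ω (s ω) (z ω) := by
  rw [← tower P W t (fun ω x => dotProduct (s ω) (Mdiff P W t x) *
    dotProduct (z ω) (Mdiff P W t x))]
  · simp only [qf_eq]
  · intro x y h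
    funext w
    rw [hs x y h, hz x y h]

lemma energy (P : FinProb Ω) (W : ℕ → Ω → Fin (n+1)) (T : ℕ) (X Y B F : ℕ → Ω → ℝ)
    (Z S : ℕ → Ω → Fin (n+1) → ℝ)
    (hX : ∀ t ≤ T, measF W t (X t)) (hY : ∀ t ≤ T, measF W t (Y t))
    (hZ : ∀ t < T, measF W t (Z t)) (hB : ∀ t < T, measF W t (B t))
    (hS : ∀ t < T, measF W t (S t))
    (eX : ∀ t < T, ∀ ω, X (t+1) ω - X t ω = B t ω + dotProduct (S t ω) (Mdiff P W t ω))
    (eY : ∀ t < T, ∀ ω, Y (t+1) ω - Y t ω = - F (t+1) ω + dotProduct (Z t ω) (Mdiff P W t ω))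
    (h0 : ∀ ω, X 0 ω = 0) :
    ∑ ω, P.p ω * (X T ω * Y T ω) = (∑ t ∈ range T, ∑ ω, P.p ω *
      (- (X t ω * F t ω) + Y t ω * B t ω + qf P W t ω (S t ω) (Z t ω))) +
      ∑ ω, P.p ω * (-(X T ω * F T ω)) := by
  induction T with
  | zero => simp [h0]
  | succ T ih =>
    have ih' := ih (fun t ht => hX t (by omega)) (fun t ht => hY t (by omega))
      (fun t ht => hZ t (by omega)) (fun t ht => hB t (by omega)) (fun t ht => hS t (by omega))
      (fun t ht => eX t (by omega)) (fun t ht => eY t (by omega))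
    rw [Finset.sum_range_succ]
    have hT : T < T + 1 := Nat.lt_succ_self T
    have k1 := E_gM P W T (X T) (Z T) (hX T hT.le) (hZ T hT)
    have k2 := E_gM P W T (B T) (Z T) (hB T hT) (hZ T hT)
    have k3 := E_gM P W T (Y T) (S T) (hY T hT.le) (hS T hT)
    have k4 := E_MM P W T (S T) (Z T) (hS T hT) (hZ T hT)
    have key : ∑ ω, P.p ω * (X (T+1) ω * Y (T+1) ω) = ∑ ω, (P.p ω * (X T ω * Y T ω) +
        P.p ω * (-(X (T+1) ω * F (T+1) ω)) + P.p ω * (Y T ω * B T ω) +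
        P.p ω * (X T ω * dotProduct (Z T ω) (Mdiff P W T ω)) +
        P.p ω * (B T ω * dotProduct (Z T ω) (Mdiff P W T ω)) +
        P.p ω * (Y T ω * dotProduct (S T ω) (Mdiff P W T ω)) +
        P.p ω * (dotProduct (S T ω) (Mdiff P W T ω) * dotProduct (Z T ω) (Mdiff P W T ω))) := by
      apply Finset.sum_congr rfl
      intro ω _
      have e1 := eX T hT ω
      have e2 := eY T hT ω
      have e3 : Y (T+1) ω = Y T ω + (- F (T+1) ω + dotProduct (Z T ω) (Mdiff P W T ω)) := by
        linarith
      have e4 : X (T+1) ω = X T ω + (B T ω + dotProduct (S T ω) (Mdiff P W T ω)) := by linarith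
      rw [e3, e4]
      ring
    simp only [Finset.sum_add_distrib] at key
    rw [k1, k2, k3, k4, ih'] at key
    rw [key]
    simp only [mul_add, Finset.sum_add_distrib]
    have : ∑ ω, P.p ω * -(X T ω * F T ω) = ∑ ω, P.p ω * -(X T ω * F T ω) := rfl
    ring

lemma qf_lin (P : FinProb Ω) (W : ℕ → Ω → Fin (n+1)) (t : ℕ) (ω : Ω) (a c : ℝ)
    (s z s0 w : Fin (n+1) → ℝ) :
    qf P W t ω (a • s - c • z + s0) w =
      a * qf P W t ω s w - c * qf P W t ω z w + qf P W t ω s0 w := by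
  simp only [qf, Matrix.add_vecMul, Matrix.sub_vecMul, Matrix.smul_vecMul, add_dotProduct,
    sub_dotProduct, smul_dotProduct, smul_eq_mul]

structure Hyp (c1 c2 : ℝ) (T : ℕ) (P : FinProb Ω) (W : ℕ → Ω → Fin (n + 1))
    (b f : ℕ → Ω → ℝ → ℝ → (Fin n → ℝ) → ℝ)
    (σ : ℕ → Ω → ℝ → ℝ → (Fin n → ℝ) → (Fin (n + 1) → ℝ))
    (h : Ω → ℝ → ℝ) : Prop where
  hP : ∀ t < T, ∀ k ω, 0 < Pt P W t k ω
  mb : ∀ t x y zi, measF W t (fun ω => b t ω x y zi)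
  mσ : ∀ t x y zi, measF W t (fun ω => σ t ω x y zi)
  mf : ∀ t x y zi, measF W t (fun ω => f t ω x y zi)
  mh : measF W T h
  fT : ∀ ω x y zi zi', f T ω x y zi = f T ω x y zi'
  lip : ∀ t < T, ∀ ω x y (zi : Fin n → ℝ) x' y' (zi' : Fin n → ℝ),
            |f t ω x y zi - f t ω x' y' zi'| + |b t ω x y zi - b t ω x' y' zi'| +
                nr (Matrix.vecMul (σ t ω x y zi - σ t ω x' y' zi') (EMM P W t ω)) ≤
              c1 * (|x - x'| + |y - y'| + nr (zi - zi'))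
  lipT : ∀ ω x y (zi : Fin n → ℝ) x' y' (zi' : Fin n → ℝ),
            |f T ω x y zi - f T ω x' y' zi'| ≤ c1 * (|x - x'| + |y - y'|)
  liph : ∀ ω x x', |h ω x - h ω x'| ≤ c1 * |x - x'|
  mon : ∀ t, 1 ≤ t → t < T → ∀ ω x y x' y' (z z' : Fin (n + 1) → ℝ),
            (-(f t ω x y (zItil z)) + f t ω x' y' (zItil z')) * (x - x') +
                (b t ω x y (zItil z) - b t ω x' y' (zItil z')) * (y - y') +
                dotProduct
                  (Matrix.vecMul (σ t ω x y (zItil z) - σ t ω x' y' (zItil z')) (EMM P W t ω))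
                  (z - z') ≤
              -c2 * (|x - x'| + |y - y'| + nr (zItil (z - z'))) ^ 2
  monT : ∀ ω x y x' y' (zi zi' : Fin n → ℝ),
            (-(f T ω x y zi) + f T ω x' y' zi') * (x - x') ≤ -c2 * (x - x') ^ 2
  mon0 : ∀ ω x y x' y' (z z' : Fin (n + 1) → ℝ),
            (b 0 ω x y (zItil z) - b 0 ω x' y' (zItil z')) * (y - y') +
                dotProduct
                  (Matrix.vecMul (σ 0 ω x y (zItil z) - σ 0 ω x' y' (zItil z')) (EMM P W 0 ω))
                  (z - z') ≤
              -c2 * ((y - y') ^ 2 + nr (zItil (z - z')) ^ 2)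
  monh : ∀ ω x x', (h ω x - h ω x') * (x - x') ≥ c2 * (x - x') ^ 2

lemma ar_young (κ x e ε : ℝ) (hκ : 0 < κ) (he : |e| ≤ ε) :
    x * e ≤ κ/2 * x^2 + ε^2/(2*κ) := by
  have h1 : e^2 ≤ ε^2 := sq_le_sq' (by linarith [abs_le.1 he]) (by linarith [abs_le.1 he])
  have h2 : e^2/(2*κ) ≤ ε^2/(2*κ) := by gcongr
  have h3 : κ/2 * x^2 + e^2/(2*κ) - x*e = (κ*x-e)^2/(2*κ) := by field_simp; ring
  have h4 : 0 ≤ (κ*x-e)^2/(2*κ) := by positivity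
  linarith

lemma ar_int (α c2 κ x y A B D q ν f0 b0 s0 ε : ℝ) (hc2 : 0 < c2) (hα : 0 ≤ α) (hκ : 0 < κ)
    (hκα : κ ≤ α * c2 + 1 - α) (hm : -A * x + B * y + D ≤ -c2 * (x^2 + y^2 + ν^2))
    (hq0 : 0 ≤ q) (hq : q ≤ ν^2) (hf : |f0| ≤ ε) (hb : |b0| ≤ ε)
    (hs : s0 ≤ κ/2 * q + ε^2/(2*κ)) :
    -(x * (α * A + (1-α) * x + f0)) + y * (α * B - (1-α) * y + b0) + (α * D - (1-α) * q + s0) ≤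
      - (κ/2) * (x^2 + y^2 + q) + 3 * (ε^2/(2*κ)) := by
  have h1 := ar_young κ (-x) f0 ε hκ hf
  have h2 := ar_young κ y b0 ε hκ hb
  have h3 := mul_le_mul_of_nonneg_left hm hα
  have h4 := mul_le_mul_of_nonneg_left hq (mul_nonneg hα hc2.le)
  have h5 : 0 ≤ (α * c2 + 1 - α - κ) * (x^2+y^2+q) :=
    mul_nonneg (by linarith) (by positivity)
  nlinarith

lemma ar_T (α c2 κ x y A G f0 h0 ε : ℝ) (hα : 0 ≤ α) (hκ : 0 < κ)
    (hκα : κ ≤ α * c2 + 1 - α) (hm : -A * x ≤ -c2 * x^2) (hh : G * x ≥ c2 * x^2)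
    (hf : |f0| ≤ ε) (hb : |h0| ≤ ε) (hy : y = α * G + (1-α) * x + h0) :
    -(x * (α * A + (1-α) * x + f0)) - x * y ≤ - (κ/2) * x^2 + 3 * (ε^2/(2*κ)) := by
  have h1 := ar_young κ (-x) f0 ε hκ hf
  have h2 := ar_young κ (-x) h0 ε hκ hb
  have h3 := mul_le_mul_of_nonneg_left hm hα
  have h4 := mul_le_mul_of_nonneg_left hh hα
  have h5 : 0 ≤ (α * c2 + 1 - α - κ) * x^2 := mul_nonneg (by linarith) (by positivity)
  have h6 : 0 ≤ κ * x^2 := by positivity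
  have h7 : 0 ≤ ε^2/(2*κ) := by positivity
  subst hy
  nlinarith

lemma abs_sq_le (x K ε : ℝ) (hε : 0 ≤ ε) (hx : x^2 ≤ K * ε^2) : |x| ≤ Real.sqrt K * ε := by
  have := Real.abs_le_sqrt hx
  rwa [Real.sqrt_mul' _ (sq_nonneg _), Real.sqrt_sq hε] at this

lemma measF_comp {W : ℕ → Ω → Fin (n + 1)} {t : ℕ} {E : Type*}
    (g : Ω → ℝ → ℝ → (Fin n → ℝ) → E) (hg : ∀ x y zi, measF W t (fun ω => g ω x y zi))
    {X Y : Ω → ℝ} {Z : Ω → Fin (n+1) → ℝ} (hX : measF W t X) (hY : measF W t Y)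
    (hZ : measF W t Z) : measF W t (fun ω => g ω (X ω) (Y ω) (zItil (Z ω))) := by
  intro ω ω' hω
  simp only [hX ω ω' hω, hY ω ω' hω, hZ ω ω' hω]
  exact hg _ _ _ ω ω' hω

lemma exists_m (P : FinProb Ω) : ∃ m : ℝ, 0 < m ∧ ∀ x, m ≤ P.p x := by
  rcases isEmpty_or_nonempty Ω with h | h
  · exact ⟨1, one_pos, fun x => (h.false x).elim⟩
  · obtain ⟨x, hx⟩ := Finite.exists_min P.p
    exact ⟨P.p x, P.pos x, hx⟩

lemma sum_aux1 (P : FinProb Ω) (g : Ω → ℝ) (c e : ℝ) :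
    ∑ ω, (c * g ω + P.p ω * e) = c * (∑ ω, g ω) + e := by
  rw [Finset.sum_add_distrib, ← Finset.mul_sum, ← Finset.sum_mul, P.sum_one, one_mul]

lemma sum_aux (P : FinProb Ω) (T : ℕ) (g : ℕ → Ω → ℝ) (c e : ℝ) :
    ∑ t ∈ range T, ∑ ω, (c * g t ω + P.p ω * e) = c * (∑ t ∈ range T, ∑ ω, g t ω) + T * e := by
  simp only [sum_aux1]
  rw [Finset.sum_add_distrib, ← Finset.mul_sum]
  simp

/-- quadratic a priori estimate -/
lemma apriori_sq {c1 c2 : ℝ} {T : ℕ} {P : FinProb Ω} {W : ℕ → Ω → Fin (n + 1)}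
    {b f : ℕ → Ω → ℝ → ℝ → (Fin n → ℝ) → ℝ}
    {σ : ℕ → Ω → ℝ → ℝ → (Fin n → ℝ) → (Fin (n + 1) → ℝ)}
    {h : Ω → ℝ → ℝ} (hc2 : 0 < c2) (hT : 1 ≤ T) (H : Hyp c1 c2 T P W b f σ h)
    (κ : ℝ) (hκ : 0 < κ) (α : ℝ) (hα : 0 ≤ α) (hκα : κ ≤ α * c2 + 1 - α)
    (x0 : ℝ) (b0 f0 : ℕ → Ω → ℝ) (σ0 : ℕ → Ω → Fin (n + 1) → ℝ) (h0 : Ω → ℝ)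
    (b0' f0' : ℕ → Ω → ℝ) (σ0' : ℕ → Ω → Fin (n + 1) → ℝ) (h0' : Ω → ℝ)
    (X Y : ℕ → Ω → ℝ) (Z : ℕ → Ω → Fin (n + 1) → ℝ)
    (X' Y' : ℕ → Ω → ℝ) (Z' : ℕ → Ω → Fin (n + 1) → ℝ)
    (mb0 : ∀ t, measF W t (b0 t)) (ms0 : ∀ t, measF W t (σ0 t))
    (mb0' : ∀ t, measF W t (b0' t)) (ms0' : ∀ t, measF W t (σ0' t))
    (hs : IsSolP P W T b f σ h x0 α b0 f0 σ0 h0 X Y Z)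
    (hs' : IsSolP P W T b f σ h x0 α b0' f0' σ0' h0' X' Y' Z')
    (ε : ℝ)
    (eb : ∀ t ≤ T, ∀ ω, |b0 t ω - b0' t ω| ≤ ε) (ef : ∀ t ≤ T, ∀ ω, |f0 t ω - f0' t ω| ≤ ε)
    (es : ∀ t ≤ T, ∀ ω, nr (zItil (σ0 t ω - σ0' t ω)) ≤ ε) (eh : ∀ ω, |h0 ω - h0' ω| ≤ ε) :
    (∑ t ∈ range T, ∑ ω, P.p ω * ((X t ω - X' t ω)^2 + (Y t ω - Y' t ω)^2 +
        qf P W t ω (Z t ω - Z' t ω) (Z t ω - Z' t ω))) + ∑ ω, P.p ω * (X T ω - X' T ω)^2 ≤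
      3 * (T+1) / κ^2 * ε^2 := by
  obtain ⟨mX, mY, mZ, eX, eY, iX, tY⟩ := hs
  obtain ⟨mX', mY', mZ', eX', eY', iX', tY'⟩ := hs'
  have en := energy P W T (fun t ω => X t ω - X' t ω) (fun t ω => Y t ω - Y' t ω)
    (fun t ω => α * (b t ω (X t ω) (Y t ω) (zItil (Z t ω)) -
        b t ω (X' t ω) (Y' t ω) (zItil (Z' t ω))) - (1-α) * (Y t ω - Y' t ω) +
        (b0 t ω - b0' t ω))
    (fun t ω => α * (f t ω (X t ω) (Y t ω) (zItil (Z t ω)) -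
        f t ω (X' t ω) (Y' t ω) (zItil (Z' t ω))) + (1-α) * (X t ω - X' t ω) +
        (f0 t ω - f0' t ω))
    (fun t ω => Z t ω - Z' t ω)
    (fun t ω => α • (σ t ω (X t ω) (Y t ω) (zItil (Z t ω)) -
        σ t ω (X' t ω) (Y' t ω) (zItil (Z' t ω))) - (1-α) • (Z t ω - Z' t ω) +
        (σ0 t ω - σ0' t ω))
    (fun t ht ω ω' hω => by simp only [mX t ht ω ω' hω, mX' t ht ω ω' hω])
    (fun t ht ω ω' hω => by simp only [mY t ht ω ω' hω, mY' t ht ω ω' hω])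
    (fun t ht ω ω' hω => by simp only [mZ t ht ω ω' hω, mZ' t ht ω ω' hω])
    (fun t ht ω ω' hω => by
      have k1 := measF_comp (b t) (H.mb t) (mX t ht.le) (mY t ht.le) (mZ t ht) ω ω' hω
      have k2 := measF_comp (b t) (H.mb t) (mX' t ht.le) (mY' t ht.le) (mZ' t ht) ω ω' hω
      beta_reduce at k1 k2 ⊢
      rw [k1, k2, mY t ht.le ω ω' hω, mY' t ht.le ω ω' hω, mb0 t ω ω' hω, mb0' t ω ω' hω])
    (fun t ht ω ω' hω => by
      have k1 := measF_comp (σ t) (H.mσ t) (mX t ht.le) (mY t ht.le) (mZ t ht) ω ω' hω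
      have k2 := measF_comp (σ t) (H.mσ t) (mX' t ht.le) (mY' t ht.le) (mZ' t ht) ω ω' hω
      beta_reduce at k1 k2 ⊢
      rw [k1, k2, mZ t ht ω ω' hω, mZ' t ht ω ω' hω, ms0 t ω ω' hω, ms0' t ω ω' hω])
    (fun t ht ω => by
      have k1 := eX t ht ω
      have k2 := eX' t ht ω
      have k3 : (α • (σ t ω (X t ω) (Y t ω) (zItil (Z t ω)) -
        σ t ω (X' t ω) (Y' t ω) (zItil (Z' t ω))) - (1-α) • (Z t ω - Z' t ω) +
        (σ0 t ω - σ0' t ω)) =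
        (fun j => α * σ t ω (X t ω) (Y t ω) (zItil (Z t ω)) j + (1 - α) * (-(Z t ω j)) +
          σ0 t ω j) - (fun j => α * σ t ω (X' t ω) (Y' t ω) (zItil (Z' t ω)) j +
            (1 - α) * (-(Z' t ω j)) + σ0' t ω j) := by
        funext j
        simp only [Pi.add_apply, Pi.sub_apply, Pi.smul_apply, smul_eq_mul]
        ring
      simp only [k3, sub_dotProduct]
      linarith)
    (fun t ht ω => by
      have k1 := eY t ht ω
      have k2 := eY' t ht ω
      simp only [sub_dotProduct]
      linarith)
    (fun ω => by simp only [iX, iX', sub_self])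
  have hpt : ∀ t ∈ range T, ∀ ω, P.p ω * (-((X t ω - X' t ω) * (α * (f t ω (X t ω) (Y t ω) (zItil (Z t ω)) -
        f t ω (X' t ω) (Y' t ω) (zItil (Z' t ω))) + (1-α) * (X t ω - X' t ω) +
        (f0 t ω - f0' t ω))) + (Y t ω - Y' t ω) * (α * (b t ω (X t ω) (Y t ω) (zItil (Z t ω)) -
        b t ω (X' t ω) (Y' t ω) (zItil (Z' t ω))) - (1-α) * (Y t ω - Y' t ω) +
        (b0 t ω - b0' t ω)) + qf P W t ω (α • (σ t ω (X t ω) (Y t ω) (zItil (Z t ω)) -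
        σ t ω (X' t ω) (Y' t ω) (zItil (Z' t ω))) - (1-α) • (Z t ω - Z' t ω) +
        (σ0 t ω - σ0' t ω)) (Z t ω - Z' t ω)) ≤
      -(κ/2) * (P.p ω * ((X t ω - X' t ω)^2 + (Y t ω - Y' t ω)^2 +
        qf P W t ω (Z t ω - Z' t ω) (Z t ω - Z' t ω))) + P.p ω * (3 * (ε^2/(2*κ))) := by
    intro t ht ω
    have ht' : t < T := Finset.mem_range.1 ht
    rw [qf_lin]
    have hq := qf_le P W t ω (Z t ω - Z' t ω)
    have hq0 := qf_nonneg P W t ω (Z t ω - Z' t ω)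
    have hsy := qf_young P W t ω (σ0 t ω - σ0' t ω) (Z t ω - Z' t ω) κ hκ
    have hsl := qf_le P W t ω (σ0 t ω - σ0' t ω)
    have hse : qf P W t ω (σ0 t ω - σ0' t ω) (σ0 t ω - σ0' t ω) ≤ ε^2 :=
      hsl.trans (pow_le_pow_left₀ (nr_nonneg _) (es t ht'.le ω) 2)
    have hse2 : 1/(2*κ) * qf P W t ω (σ0 t ω - σ0' t ω) (σ0 t ω - σ0' t ω) ≤ ε^2/(2*κ) := by
      rw [div_mul_eq_mul_div, one_mul]
      gcongr
    have hm : -(f t ω (X t ω) (Y t ω) (zItil (Z t ω)) -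
        f t ω (X' t ω) (Y' t ω) (zItil (Z' t ω))) * (X t ω - X' t ω) +
        (b t ω (X t ω) (Y t ω) (zItil (Z t ω)) -
        b t ω (X' t ω) (Y' t ω) (zItil (Z' t ω))) * (Y t ω - Y' t ω) +
        qf P W t ω (σ t ω (X t ω) (Y t ω) (zItil (Z t ω)) -
        σ t ω (X' t ω) (Y' t ω) (zItil (Z' t ω))) (Z t ω - Z' t ω) ≤
        -c2 * ((X t ω - X' t ω)^2 + (Y t ω - Y' t ω)^2 + nr (zItil (Z t ω - Z' t ω))^2) := by
      rcases Nat.eq_zero_or_pos t with h0t | h0t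
      · subst h0t
        have k := H.mon0 ω (X 0 ω) (Y 0 ω) (X' 0 ω) (Y' 0 ω) (Z 0 ω) (Z' 0 ω)
        have hx : X 0 ω - X' 0 ω = 0 := by rw [iX, iX', sub_self]
        rw [hx]
        unfold qf
        linarith
      · have k := H.mon t h0t ht' ω (X t ω) (Y t ω) (X' t ω) (Y' t ω) (Z t ω) (Z' t ω)
        unfold qf
        have k2 : (X t ω - X' t ω)^2 + (Y t ω - Y' t ω)^2 + nr (zItil (Z t ω - Z' t ω))^2 ≤
            (|X t ω - X' t ω| + |Y t ω - Y' t ω| + nr (zItil (Z t ω - Z' t ω)))^2 := by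
          rw [← sq_abs (X t ω - X' t ω), ← sq_abs (Y t ω - Y' t ω)]
          have a1 := abs_nonneg (X t ω - X' t ω)
          have a2 := abs_nonneg (Y t ω - Y' t ω)
          have a3 := nr_nonneg (zItil (Z t ω - Z' t ω))
          nlinarith [mul_nonneg a1 a2, mul_nonneg a1 a3, mul_nonneg a2 a3]
        have k3 := mul_le_mul_of_nonneg_left k2 hc2.le
        linarith
    have key := ar_int α c2 κ _ _ _ _ _ _ _ _ _ _ ε hc2 hα hκ hκα hm hq0 hq (ef t ht'.le ω)
      (eb t ht'.le ω) (hsy.trans (by linarith))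
    have := mul_le_mul_of_nonneg_left key (P.pos ω).le
    linarith
  have hptT : ∀ ω, P.p ω * (-((X T ω - X' T ω) * (α * (f T ω (X T ω) (Y T ω) (zItil (Z T ω)) -
        f T ω (X' T ω) (Y' T ω) (zItil (Z' T ω))) + (1-α) * (X T ω - X' T ω) +
        (f0 T ω - f0' T ω)))) - P.p ω * ((X T ω - X' T ω) * (Y T ω - Y' T ω)) ≤
      -(κ/2) * (P.p ω * (X T ω - X' T ω)^2) + P.p ω * (3 * (ε^2/(2*κ))) := by
    intro ω
    have hm := H.monT ω (X T ω) (Y T ω) (X' T ω) (Y' T ω) (zItil (Z T ω)) (zItil (Z' T ω))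
    have key := ar_T α c2 κ (X T ω - X' T ω) (Y T ω - Y' T ω)
      (f T ω (X T ω) (Y T ω) (zItil (Z T ω)) - f T ω (X' T ω) (Y' T ω) (zItil (Z' T ω)))
      (h ω (X T ω) - h ω (X' T ω)) (f0 T ω - f0' T ω) (h0 ω - h0' ω) ε hα hκ hκα
      (by linarith) (H.monh ω _ _) (ef T le_rfl ω) (eh ω) (by rw [tY, tY']; ring)
    have := mul_le_mul_of_nonneg_left key (P.pos ω).le
    linarith
  have s1 := Finset.sum_le_sum fun t ht => Finset.sum_le_sum fun ω (_ : ω ∈ univ) => hpt t ht ω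
  have s2 := Finset.sum_le_sum fun ω (_ : ω ∈ univ) => hptT ω
  rw [sum_aux] at s1
  rw [sum_aux1, Finset.sum_sub_distrib] at s2
  beta_reduce at en
  set R1 := ∑ t ∈ range T, ∑ ω, P.p ω * ((X t ω - X' t ω)^2 + (Y t ω - Y' t ω)^2 +
        qf P W t ω (Z t ω - Z' t ω) (Z t ω - Z' t ω)) with hR1
  set R2 := ∑ ω, P.p ω * (X T ω - X' T ω)^2 with hR2
  have fin : κ/2 * (R1 + R2) ≤ (T+1) * (3 * (ε^2/(2*κ))) := by linarith
  have e1 : 3 * (T+1) / κ^2 * ε^2 = (2/κ) * ((T+1) * (3 * (ε^2/(2*κ)))) := by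
    field_simp
  have e2 : R1 + R2 = (2/κ) * (κ/2 * (R1 + R2)) := by field_simp
  rw [e1, e2]
  exact mul_le_mul_of_nonneg_left fin (by positivity)

lemma apriori {c1 c2 : ℝ} {T : ℕ} {P : FinProb Ω} {W : ℕ → Ω → Fin (n + 1)}
    {b f : ℕ → Ω → ℝ → ℝ → (Fin n → ℝ) → ℝ}
    {σ : ℕ → Ω → ℝ → ℝ → (Fin n → ℝ) → (Fin (n + 1) → ℝ)}
    {h : Ω → ℝ → ℝ} (hc1 : 0 < c1) (hc2 : 0 < c2) (hT : 1 ≤ T) (H : Hyp c1 c2 T P W b f σ h)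
    (κ : ℝ) (hκ : 0 < κ) : ∃ C : ℝ, 0 ≤ C ∧ ∀ (α : ℝ), 0 ≤ α → α ≤ 2 → κ ≤ α * c2 + 1 - α →
    ∀ (x0 : ℝ) (b0 f0 : ℕ → Ω → ℝ) (σ0 : ℕ → Ω → Fin (n + 1) → ℝ) (h0 : Ω → ℝ)
    (b0' f0' : ℕ → Ω → ℝ) (σ0' : ℕ → Ω → Fin (n + 1) → ℝ) (h0' : Ω → ℝ)
    (X Y : ℕ → Ω → ℝ) (Z : ℕ → Ω → Fin (n + 1) → ℝ)
    (X' Y' : ℕ → Ω → ℝ) (Z' : ℕ → Ω → Fin (n + 1) → ℝ),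
    (∀ t, measF W t (b0 t)) → (∀ t, measF W t (σ0 t)) →
    (∀ t, measF W t (b0' t)) → (∀ t, measF W t (σ0' t)) →
    (IsSolP P W T b f σ h x0 α b0 f0 σ0 h0 X Y Z) →
    (IsSolP P W T b f σ h x0 α b0' f0' σ0' h0' X' Y' Z') →
    ∀ (ε : ℝ), 0 ≤ ε →
    (∀ t ≤ T, ∀ ω, |b0 t ω - b0' t ω| ≤ ε) → (∀ t ≤ T, ∀ ω, |f0 t ω - f0' t ω| ≤ ε) →
    (∀ t ≤ T, ∀ ω, nr (zItil (σ0 t ω - σ0' t ω)) ≤ ε) → (∀ ω, |h0 ω - h0' ω| ≤ ε) →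
    (∀ t ≤ T, ∀ ω, |X t ω - X' t ω| ≤ C * ε) ∧ (∀ t ≤ T, ∀ ω, |Y t ω - Y' t ω| ≤ C * ε) ∧
    (∀ t < T, ∀ ω, nr (zItil (Z t ω - Z' t ω)) ≤ C * ε) := by
  obtain ⟨m, hm0, hm⟩ := exists_m P
  set K : ℝ := 3 * (T+1) / κ^2 / m with hK
  have hK0 : 0 ≤ K := by positivity
  set r := Real.sqrt K with hr
  have hr0 : 0 ≤ r := Real.sqrt_nonneg _
  set u := Real.sqrt (4 * n / m * K) with hu
  have hu0 : 0 ≤ u := Real.sqrt_nonneg _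
  refine ⟨(2*c1+2) * r + 1 + u, by positivity, ?_⟩
  intro α hα hα2 hκα x0 b0 f0 σ0 h0 b0' f0' σ0' h0' X Y Z X' Y' Z' mb0 ms0 mb0' ms0' hs hs' ε hε
    eb ef es eh
  have key := apriori_sq hc2 hT H κ hκ α hα hκα x0 b0 f0 σ0 h0 b0' f0' σ0' h0' X Y Z X' Y' Z'
    mb0 ms0 mb0' ms0' hs hs' ε eb ef es eh
  have nn1 : ∀ t ω, 0 ≤ (X t ω - X' t ω)^2 + (Y t ω - Y' t ω)^2 +
      qf P W t ω (Z t ω - Z' t ω) (Z t ω - Z' t ω) := fun t ω => by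
    have := qf_nonneg P W t ω (Z t ω - Z' t ω)
    positivity
  have nn2 : ∀ ω, 0 ≤ P.p ω * (X T ω - X' T ω)^2 := fun ω =>
    mul_nonneg (P.pos ω).le (sq_nonneg _)
  have conv : ∀ ω a, 0 ≤ a → P.p ω * a ≤ 3 * (T+1) / κ^2 * ε^2 → a ≤ K * ε^2 := by
    intro ω a ha h1
    have h2 : m * a ≤ 3 * (T+1) / κ^2 * ε^2 := (mul_le_mul_of_nonneg_right (hm ω) ha).trans h1
    have h3 : K * ε^2 = (3 * (T+1) / κ^2 * ε^2) / m := by rw [hK]; ring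
    rw [h3, le_div_iff₀ hm0]
    linarith
  have nnS : ∀ t, 0 ≤ ∑ ω, P.p ω * ((X t ω - X' t ω)^2 + (Y t ω - Y' t ω)^2 +
      qf P W t ω (Z t ω - Z' t ω) (Z t ω - Z' t ω)) := fun t =>
    Finset.sum_nonneg fun ω _ => mul_nonneg (P.pos ω).le (nn1 t ω)
  have b1 : ∀ t < T, ∀ ω, (X t ω - X' t ω)^2 + (Y t ω - Y' t ω)^2 +
      qf P W t ω (Z t ω - Z' t ω) (Z t ω - Z' t ω) ≤ K * ε^2 := by
    intro t ht ω
    apply conv ω _ (nn1 t ω)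
    have g1 := Finset.single_le_sum (s := univ) (f := fun ω => P.p ω * ((X t ω - X' t ω)^2 +
      (Y t ω - Y' t ω)^2 + qf P W t ω (Z t ω - Z' t ω) (Z t ω - Z' t ω)))
      (fun ω _ => mul_nonneg (P.pos ω).le (nn1 t ω)) (Finset.mem_univ ω)
    have g2 := Finset.single_le_sum (s := range T) (f := fun t => ∑ ω, P.p ω * ((X t ω - X' t ω)^2 +
      (Y t ω - Y' t ω)^2 + qf P W t ω (Z t ω - Z' t ω) (Z t ω - Z' t ω)))
      (fun t _ => nnS t) (Finset.mem_range.2 ht)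
    have g3 := Finset.sum_nonneg fun ω (_ : ω ∈ univ) => nn2 ω
    beta_reduce at g1 g2
    linarith
  have b2 : ∀ ω, (X T ω - X' T ω)^2 ≤ K * ε^2 := by
    intro ω
    apply conv ω _ (sq_nonneg _)
    have g1 := Finset.single_le_sum (s := univ) (f := fun ω => P.p ω * (X T ω - X' T ω)^2)
      (fun ω _ => nn2 ω) (Finset.mem_univ ω)
    have g3 := Finset.sum_nonneg fun t (_ : t ∈ range T) => nnS t
    beta_reduce at g1
    linarith
  have rX : ∀ t ≤ T, ∀ ω, |X t ω - X' t ω| ≤ r * ε := by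
    intro t ht ω
    apply abs_sq_le _ _ _ hε
    rcases ht.lt_or_eq with h1 | h1
    · have := b1 t h1 ω
      have := qf_nonneg P W t ω (Z t ω - Z' t ω)
      nlinarith [sq_nonneg (Y t ω - Y' t ω)]
    · subst h1
      exact b2 ω
  have hrε : 0 ≤ r * ε := mul_nonneg hr0 hε
  have huε : 0 ≤ u * ε := mul_nonneg hu0 hε
  have hcrε : 0 ≤ c1 * (r * ε) := mul_nonneg hc1.le hrε
  refine ⟨?_, ?_, ?_⟩
  · intro t ht ω
    have := rX t ht ω
    nlinarith
  · intro t ht ω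
    rcases ht.lt_or_eq with h1 | h1
    · have h2 : |Y t ω - Y' t ω| ≤ r * ε := by
        apply abs_sq_le _ _ _ hε
        have := b1 t h1 ω
        have := qf_nonneg P W t ω (Z t ω - Z' t ω)
        nlinarith [sq_nonneg (X t ω - X' t ω)]
      nlinarith
    · subst h1
      have hx := rX t le_rfl ω
      have e1 : Y t ω - Y' t ω = α * (h ω (X t ω) - h ω (X' t ω)) + (1-α) * (X t ω - X' t ω) +
          (h0 ω - h0' ω) := by
        rw [hs.2.2.2.2.2.2 ω, hs'.2.2.2.2.2.2 ω]
        ring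
      have e2 : |α * (h ω (X t ω) - h ω (X' t ω))| ≤ 2 * (c1 * (r * ε)) := by
        rw [abs_mul, abs_of_nonneg hα]
        have := (H.liph ω (X t ω) (X' t ω)).trans (mul_le_mul_of_nonneg_left hx hc1.le)
        exact mul_le_mul hα2 this (abs_nonneg _) (by norm_num)
      have e3 : |(1-α) * (X t ω - X' t ω)| ≤ 1 * (r * ε) := by
        rw [abs_mul]
        exact mul_le_mul (abs_le.2 ⟨by linarith, by linarith⟩) hx (abs_nonneg _) (by norm_num)
      have e4 := eh ω
      rw [e1]
      have e5 := abs_add_three (α * (h ω (X t ω) - h ω (X' t ω))) ((1-α) * (X t ω - X' t ω))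
          (h0 ω - h0' ω)
      nlinarith
  · intro t ht ω
    have h2 : |nr (zItil (Z t ω - Z' t ω))| ≤ u * ε := by
      apply abs_sq_le _ _ _ hε
      have g1 := b1 t ht ω
      have g2 := qf_ge P W t ω (Z t ω - Z' t ω) (fun k => H.hP t ht k ω) m hm0 hm
      have g3 : qf P W t ω (Z t ω - Z' t ω) (Z t ω - Z' t ω) ≤ K * ε^2 := by
        nlinarith [sq_nonneg (X t ω - X' t ω), sq_nonneg (Y t ω - Y' t ω)]
      have g4 := mul_le_mul_of_nonneg_left g3 (show 0 ≤ 4 * (n:ℝ) / m by positivity)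
      linarith
    have h3 := le_abs_self (nr (zItil (Z t ω - Z' t ω)))
    nlinarith

lemma norm_le_nr {m : ℕ} (v : Fin m → ℝ) : ‖v‖ ≤ nr v := by
  rw [pi_norm_le_iff_of_nonneg (nr_nonneg v)]
  intro i
  rw [Real.norm_eq_abs]
  apply Real.abs_le_sqrt
  exact Finset.single_le_sum (f := fun j => v j ^ 2) (fun _ _ => sq_nonneg _) (Finset.mem_univ i)

lemma nr_le_norm {m : ℕ} (v : Fin m → ℝ) : nr v ≤ (Real.sqrt m + 1) * ‖v‖ := by
  have h1 : nr v ≤ Real.sqrt (m * ‖v‖^2) := by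
    apply Real.sqrt_le_sqrt
    calc ∑ j, v j ^ 2 ≤ ∑ _j : Fin m, ‖v‖^2 := by
          apply Finset.sum_le_sum
          intro j _
          rw [← sq_abs]
          exact pow_le_pow_left₀ (abs_nonneg _) (norm_le_pi_norm v j) 2
      _ = _ := by simp
  rw [Real.sqrt_mul (Nat.cast_nonneg m), Real.sqrt_sq (norm_nonneg _)] at h1
  nlinarith [norm_nonneg v]

/-- The perturbation operator of the continuation step. -/
def Kop (T : ℕ) (b f : ℕ → Ω → ℝ → ℝ → (Fin n → ℝ) → ℝ)
    (σ : ℕ → Ω → ℝ → ℝ → (Fin n → ℝ) → (Fin (n + 1) → ℝ))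
    (h : Ω → ℝ → ℝ) (X Y : ℕ → Ω → ℝ) (Z : ℕ → Ω → Fin (n + 1) → ℝ) (t : ℕ) (ω : Ω) :
    ℝ × ℝ × (Fin n → ℝ) × ℝ :=
  if t < T then (b t ω (X t ω) (Y t ω) (zItil (Z t ω)) + Y t ω,
    f t ω (X t ω) (Y t ω) (zItil (Z t ω)) - X t ω,
    zItil (σ t ω (X t ω) (Y t ω) (zItil (Z t ω))) + zItil (Z t ω), 0)
  else (0, f T ω (X T ω) (Y T ω) 0 - X T ω, 0, h ω (X T ω) - X T ω)

lemma Kop_meas {c1 c2 : ℝ} {T : ℕ} {P : FinProb Ω} {W : ℕ → Ω → Fin (n + 1)}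
    {b f : ℕ → Ω → ℝ → ℝ → (Fin n → ℝ) → ℝ}
    {σ : ℕ → Ω → ℝ → ℝ → (Fin n → ℝ) → (Fin (n + 1) → ℝ)}
    {h : Ω → ℝ → ℝ} (H : Hyp c1 c2 T P W b f σ h) {X Y : ℕ → Ω → ℝ}
    {Z : ℕ → Ω → Fin (n + 1) → ℝ}
    (mX : ∀ t ≤ T, measF W t (X t)) (mY : ∀ t ≤ T, measF W t (Y t))
    (mZ : ∀ t < T, measF W t (Z t)) (t : ℕ) (htT : t ≤ T) :
    measF W t (Kop T b f σ h X Y Z t) := by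
  intro ω ω' hω
  unfold Kop
  by_cases ht : t < T
  · simp only [if_pos ht]
    have k1 := measF_comp (b t) (H.mb t) (mX t htT) (mY t htT) (mZ t ht) ω ω' hω
    have k2 := measF_comp (f t) (H.mf t) (mX t htT) (mY t htT) (mZ t ht) ω ω' hω
    have k3 := measF_comp (σ t) (H.mσ t) (mX t htT) (mY t htT) (mZ t ht) ω ω' hω
    beta_reduce at k1 k2 k3
    rw [k1, k2, k3, mX t htT ω ω' hω, mY t htT ω ω' hω, mZ t ht ω ω' hω]
  · have : t = T := by omega
    subst this
    simp only [if_neg ht]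
    have k2 := H.mf t (X t ω) (Y t ω) 0 ω ω' hω
    beta_reduce at k2
    rw [k2, H.mh ω ω' hω, mX t htT ω ω' hω, mY t htT ω ω' hω]

lemma Kop_lip {c1 c2 : ℝ} {T : ℕ} {P : FinProb Ω} {W : ℕ → Ω → Fin (n + 1)}
    {b f : ℕ → Ω → ℝ → ℝ → (Fin n → ℝ) → ℝ}
    {σ : ℕ → Ω → ℝ → ℝ → (Fin n → ℝ) → (Fin (n + 1) → ℝ)}
    {h : Ω → ℝ → ℝ} (hc1 : 0 < c1) (H : Hyp c1 c2 T P W b f σ h) : ∃ L : ℝ, 0 ≤ L ∧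
    ∀ (X Y : ℕ → Ω → ℝ) (Z : ℕ → Ω → Fin (n + 1) → ℝ)
    (X' Y' : ℕ → Ω → ℝ) (Z' : ℕ → Ω → Fin (n + 1) → ℝ) (ε : ℝ), 0 ≤ ε →
    (∀ t ≤ T, ∀ ω, |X t ω - X' t ω| ≤ ε) → (∀ t ≤ T, ∀ ω, |Y t ω - Y' t ω| ≤ ε) →
    (∀ t < T, ∀ ω, nr (zItil (Z t ω - Z' t ω)) ≤ ε) → ∀ t ≤ T, ∀ ω,
    dist (Kop T b f σ h X Y Z t ω) (Kop T b f σ h X' Y' Z' t ω) ≤ L * ε := by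
  obtain ⟨m, hm0, hm⟩ := exists_m P
  have hq : 0 ≤ 4 * (n:ℝ) / m := by positivity
  refine ⟨3 * c1 + 1 + (4 * n / m) * (3 * c1), by positivity, ?_⟩
  intro X Y Z X' Y' Z' ε hε hX hY hZ t htT ω
  have hcε : 0 ≤ c1 * ε := by positivity
  have hqε : 0 ≤ (4 * n / m) * (c1 * ε) := by positivity
  have hx := hX t htT ω
  have hy := hY t htT ω
  by_cases ht : t < T
  · have hz := hZ t ht ω
    have hl := H.lip t ht ω (X t ω) (Y t ω) (zItil (Z t ω)) (X' t ω) (Y' t ω) (zItil (Z' t ω))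
    rw [← zItil_sub] at hl
    have hl2 : c1 * (|X t ω - X' t ω| + |Y t ω - Y' t ω| + nr (zItil (Z t ω - Z' t ω))) ≤
        c1 * (3 * ε) := mul_le_mul_of_nonneg_left (by linarith) hc1.le
    have n1 := abs_nonneg (f t ω (X t ω) (Y t ω) (zItil (Z t ω)) -
      f t ω (X' t ω) (Y' t ω) (zItil (Z' t ω)))
    have n2 := abs_nonneg (b t ω (X t ω) (Y t ω) (zItil (Z t ω)) -
      b t ω (X' t ω) (Y' t ω) (zItil (Z' t ω)))
    have n3 := nr_nonneg (Matrix.vecMul (σ t ω (X t ω) (Y t ω) (zItil (Z t ω)) -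
      σ t ω (X' t ω) (Y' t ω) (zItil (Z' t ω))) (EMM P W t ω))
    have hs := nr_le_EMM P W t ω (σ t ω (X t ω) (Y t ω) (zItil (Z t ω)) -
      σ t ω (X' t ω) (Y' t ω) (zItil (Z' t ω))) (fun k => H.hP t ht k ω) m hm0 hm
    have hs2 : (4 * n / m) * nr (Matrix.vecMul (σ t ω (X t ω) (Y t ω) (zItil (Z t ω)) -
      σ t ω (X' t ω) (Y' t ω) (zItil (Z' t ω))) (EMM P W t ω)) ≤ (4 * n / m) * (c1 * (3 * ε)) :=
      mul_le_mul_of_nonneg_left (by linarith) hq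
    simp only [Kop, if_pos ht, Prod.dist_eq, sup_le_iff]
    refine ⟨?_, ?_, ?_, ?_⟩
    · rw [Real.dist_eq]
      have := abs_add_le (b t ω (X t ω) (Y t ω) (zItil (Z t ω)) -
        b t ω (X' t ω) (Y' t ω) (zItil (Z' t ω))) (Y t ω - Y' t ω)
      rw [show ∀ a c d e : ℝ, a + c - (d + e) = (a - d) + (c - e) by intros; ring]
      nlinarith
    · rw [Real.dist_eq]
      have := abs_sub (f t ω (X t ω) (Y t ω) (zItil (Z t ω)) -
        f t ω (X' t ω) (Y' t ω) (zItil (Z' t ω))) (X t ω - X' t ω)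
      rw [show ∀ a c d e : ℝ, a - c - (d - e) = (a - d) - (c - e) by intros; ring]
      nlinarith
    · rw [dist_eq_norm, add_sub_add_comm, ← zItil_sub, ← zItil_sub]
      have h1 := norm_le_nr (zItil (σ t ω (X t ω) (Y t ω) (zItil (Z t ω)) -
        σ t ω (X' t ω) (Y' t ω) (zItil (Z' t ω))))
      have h2 := norm_le_nr (zItil (Z t ω - Z' t ω))
      have h3 := norm_add_le (zItil (σ t ω (X t ω) (Y t ω) (zItil (Z t ω)) -
        σ t ω (X' t ω) (Y' t ω) (zItil (Z' t ω)))) (zItil (Z t ω - Z' t ω))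
      nlinarith
    · simp only [dist_self]
      positivity
  · have : t = T := by omega
    subst this
    have hl := H.lipT ω (X t ω) (Y t ω) 0 (X' t ω) (Y' t ω) 0
    have hl2 : c1 * (|X t ω - X' t ω| + |Y t ω - Y' t ω|) ≤
        c1 * (2 * ε) := mul_le_mul_of_nonneg_left (by linarith) hc1.le
    have hh := (H.liph ω (X t ω) (X' t ω)).trans (mul_le_mul_of_nonneg_left hx hc1.le)
    simp only [Kop, if_neg ht, Prod.dist_eq, sup_le_iff]
    refine ⟨?_, ?_, ?_, ?_⟩
    · simp only [dist_self]
      positivity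
    · rw [Real.dist_eq]
      have := abs_sub (f t ω (X t ω) (Y t ω) 0 - f t ω (X' t ω) (Y' t ω) 0) (X t ω - X' t ω)
      rw [show ∀ a c d e : ℝ, a - c - (d - e) = (a - d) - (c - e) by intros; ring]
      nlinarith
    · simp only [dist_self]
      positivity
    · rw [Real.dist_eq]
      have := abs_sub (h ω (X t ω) - h ω (X' t ω)) (X t ω - X' t ω)
      rw [show ∀ a c d e : ℝ, a - c - (d - e) = (a - d) - (c - e) by intros; ring]
      nlinarith

/-- extension by zero in time -/
noncomputable def extE {T : ℕ} (g : Fin (T+1) → Ω → ℝ × ℝ × (Fin n → ℝ) × ℝ) (t : ℕ) (ω : Ω) :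
    ℝ × ℝ × (Fin n → ℝ) × ℝ := if ht : t < T + 1 then g ⟨t, ht⟩ ω else 0

lemma extE_meas {T : ℕ} {W : ℕ → Ω → Fin (n + 1)}
    (g : Fin (T+1) → Ω → ℝ × ℝ × (Fin n → ℝ) × ℝ)
    (hg : ∀ t : Fin (T+1), measF W t (g t)) (t : ℕ) : measF W t (extE g t) := by
  intro ω ω' hω
  unfold extE
  by_cases ht : t < T + 1
  · simp only [dif_pos ht]
    exact hg ⟨t, ht⟩ ω ω' hω
  · simp only [dif_neg ht]

lemma extE_dist {T : ℕ} (g g' : Fin (T+1) → Ω → ℝ × ℝ × (Fin n → ℝ) × ℝ) (t : ℕ) (ω : Ω) :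
    dist (extE g t ω) (extE g' t ω) ≤ dist g g' := by
  unfold extE
  by_cases ht : t < T + 1
  · simp only [dif_pos ht]
    exact (dist_le_pi_dist (g ⟨t, ht⟩) (g' ⟨t, ht⟩) ω).trans (dist_le_pi_dist g g' ⟨t, ht⟩)
  · simp only [dif_neg ht, dist_self]
    exact dist_nonneg

lemma uniq {c1 c2 : ℝ} {T : ℕ} {P : FinProb Ω} {W : ℕ → Ω → Fin (n + 1)}
    {b f : ℕ → Ω → ℝ → ℝ → (Fin n → ℝ) → ℝ}
    {σ : ℕ → Ω → ℝ → ℝ → (Fin n → ℝ) → (Fin (n + 1) → ℝ)}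
    {h : Ω → ℝ → ℝ} (hc1 : 0 < c1) (hc2 : 0 < c2) (hT : 1 ≤ T) (H : Hyp c1 c2 T P W b f σ h)
    (κ : ℝ) (hκ : 0 < κ) (α : ℝ) (hα : 0 ≤ α) (hα2 : α ≤ 2) (hκα : κ ≤ α * c2 + 1 - α)
    (x0 : ℝ) (b0 f0 : ℕ → Ω → ℝ) (σ0 : ℕ → Ω → Fin (n + 1) → ℝ) (h0 : Ω → ℝ)
    (X Y : ℕ → Ω → ℝ) (Z : ℕ → Ω → Fin (n + 1) → ℝ)
    (X' Y' : ℕ → Ω → ℝ) (Z' : ℕ → Ω → Fin (n + 1) → ℝ)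
    (mb0 : ∀ t, measF W t (b0 t)) (ms0 : ∀ t, measF W t (σ0 t))
    (hs : IsSolP P W T b f σ h x0 α b0 f0 σ0 h0 X Y Z)
    (hs' : IsSolP P W T b f σ h x0 α b0 f0 σ0 h0 X' Y' Z') :
    (∀ t ≤ T, ∀ ω, X' t ω = X t ω ∧ Y' t ω = Y t ω) ∧
        (∀ t < T, ∀ ω, dotProduct (Z' t ω) (Mdiff P W t ω) =
            dotProduct (Z t ω) (Mdiff P W t ω)) := by
  obtain ⟨C, hC, hap⟩ := apriori hc1 hc2 hT H κ hκ
  have hnr : nr (zItil (0 : Fin (n+1) → ℝ)) = 0 := by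
    have : zItil (0 : Fin (n+1) → ℝ) = 0 := by
      funext k
      simp [zItil_apply]
    rw [this]
    simp [nr]
  obtain ⟨k1, k2, k3⟩ := hap α hα hα2 hκα x0 b0 f0 σ0 h0 b0 f0 σ0 h0 X' Y' Z' X Y Z mb0 ms0 mb0 ms0
    hs' hs 0 le_rfl (by simp) (by simp) (by simp [hnr]) (by simp)
  simp only [mul_zero, abs_nonpos_iff, sub_eq_zero] at k1 k2 k3
  refine ⟨fun t ht ω => ⟨k1 t ht ω, k2 t ht ω⟩, fun t ht ω => ?_⟩
  apply dot_M_congr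
  have h1 := (norm_le_nr _).trans (k3 t ht ω)
  rw [norm_le_zero_iff, zItil_sub, sub_eq_zero] at h1
  exact h1

lemma step {c1 c2 : ℝ} {T : ℕ} {P : FinProb Ω} {W : ℕ → Ω → Fin (n + 1)}
    {b f : ℕ → Ω → ℝ → ℝ → (Fin n → ℝ) → ℝ}
    {σ : ℕ → Ω → ℝ → ℝ → (Fin n → ℝ) → (Fin (n + 1) → ℝ)}
    {h : Ω → ℝ → ℝ} (hc1 : 0 < c1) (hc2 : 0 < c2) (hT : 1 ≤ T) (H : Hyp c1 c2 T P W b f σ h)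
    (κ : ℝ) (hκ : 0 < κ) (x0 : ℝ) : ∃ η : ℝ, 0 < η ∧ ∀ (α : ℝ), 0 ≤ α → α ≤ 2 →
      κ ≤ α * c2 + 1 - α → SolvableAt P W T b f σ h x0 α →
      ∀ δ : ℝ, 0 ≤ δ → δ ≤ η → α + δ ≤ 2 → κ ≤ (α + δ) * c2 + 1 - (α + δ) →
      SolvableAt P W T b f σ h x0 (α + δ) := by
  obtain ⟨C, hC, hap⟩ := apriori hc1 hc2 hT H κ hκ
  obtain ⟨L, hL, hlip⟩ := Kop_lip hc1 H
  set q : ℝ := Real.sqrt n + 1 with hq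
  have hq0 : 1 ≤ q := by have := Real.sqrt_nonneg (n:ℝ); linarith
  refine ⟨1 / (2 * (L * C * q + 1)), by positivity, ?_⟩
  intro α hα hα2 hκα hsolv δ hδ hδη hαδ2 hκαδ
  intro b0 f0 σ0 h0 mb0 mf0 ms0 mh0
  let E := Fin (T+1) → Ω → ℝ × ℝ × (Fin n → ℝ) × ℝ
  let S : Set E := {g | ∀ t : Fin (T+1), measF W t (g t)}
  have hSc : IsClosed S := by
    simp only [S, measF, Set.setOf_forall]
    refine isClosed_iInter fun t => isClosed_iInter fun ω => isClosed_iInter fun ω' =>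
      isClosed_iInter fun _ => ?_
    exact isClosed_eq (by fun_prop) (by fun_prop)
  haveI : CompleteSpace S := hSc.completeSpace_coe
  haveI : Nonempty S := ⟨⟨0, fun t ω ω' _ => rfl⟩⟩
  have mB : ∀ g : S, ∀ t, measF W t (fun ω => b0 t ω + δ * (extE g.1 t ω).1) :=
    fun g t ω ω' hω => by
      have := extE_meas g.1 g.2 t ω ω' hω
      simp only [this, mb0 t ω ω' hω]
  have mF : ∀ g : S, ∀ t, measF W t (fun ω => f0 t ω + δ * (extE g.1 t ω).2.1) :=
    fun g t ω ω' hω => by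
      have := extE_meas g.1 g.2 t ω ω' hω
      simp only [this, mf0 t ω ω' hω]
  have mS : ∀ g : S, ∀ t, measF W t (fun ω => σ0 t ω + δ • nz (extE g.1 t ω).2.2.1) :=
    fun g t ω ω' hω => by
      have := extE_meas g.1 g.2 t ω ω' hω
      simp only [this, ms0 t ω ω' hω]
  have mHH : ∀ g : S, measF W T (fun ω => h0 ω + δ * (extE g.1 T ω).2.2.2) :=
    fun g ω ω' hω => by
      have := extE_meas g.1 g.2 T ω ω' hω
      simp only [this, mh0 ω ω' hω]
  have hex : ∀ g : S, ∃ (X Y : ℕ → Ω → ℝ) (Z : ℕ → Ω → Fin (n + 1) → ℝ),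
      IsSolP P W T b f σ h x0 α (fun t ω => b0 t ω + δ * (extE g.1 t ω).1)
        (fun t ω => f0 t ω + δ * (extE g.1 t ω).2.1)
        (fun t ω => σ0 t ω + δ • nz (extE g.1 t ω).2.2.1)
        (fun ω => h0 ω + δ * (extE g.1 T ω).2.2.2) X Y Z := by
    intro g
    obtain ⟨X, Y, Z, hs, _⟩ := hsolv _ _ _ _ (mB g) (mF g) (mS g) (mHH g)
    exact ⟨X, Y, Z, hs⟩
  choose X Y Z hsol using hex
  let Ψ : S → S := fun g => ⟨fun t => Kop T b f σ h (X g) (Y g) (Z g) t, fun t =>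
    Kop_meas H (hsol g).1 (hsol g).2.1 (hsol g).2.2.1 t (Nat.lt_succ_iff.1 t.2)⟩
  have hΨ : ContractingWith (1/2) Ψ := by
    refine ⟨by rw [← NNReal.coe_lt_coe]; norm_num, LipschitzWith.of_dist_le_mul ?_⟩
    intro g g'
    set d := dist g g' with hd
    have hd0 : 0 ≤ d := dist_nonneg
    have hdd : ∀ t ω, dist (extE g.1 t ω) (extE g'.1 t ω) ≤ d := fun t ω => extE_dist _ _ t ω
    have hε : 0 ≤ δ * (q * d) := by positivity
    have hdq : d ≤ q * d := by nlinarith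
    have hall := hap α hα hα2 hκα x0 _ _ _ _ _ _ _ _ _ _ _ _ _ _ (mB g) (mS g) (mB g') (mS g')
      (hsol g) (hsol g') (δ * (q * d)) hε
      (fun t _ ω => by
        have h1 := hdd t ω
        simp only [Prod.dist_eq, sup_le_iff, Real.dist_eq] at h1
        rw [add_sub_add_left_eq_sub, ← mul_sub, abs_mul, abs_of_nonneg hδ]
        exact mul_le_mul_of_nonneg_left (h1.1.trans hdq) hδ)
      (fun t _ ω => by
        have h1 := hdd t ω
        simp only [Prod.dist_eq, sup_le_iff, Real.dist_eq] at h1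
        rw [add_sub_add_left_eq_sub, ← mul_sub, abs_mul, abs_of_nonneg hδ]
        exact mul_le_mul_of_nonneg_left (h1.2.1.trans hdq) hδ)
      (fun t _ ω => by
        have h1 := hdd t ω
        simp only [Prod.dist_eq, sup_le_iff] at h1
        have h2 : zItil (σ0 t ω + δ • nz (extE g.1 t ω).2.2.1 -
            (σ0 t ω + δ • nz (extE g'.1 t ω).2.2.1)) =
            δ • ((extE g.1 t ω).2.2.1 - (extE g'.1 t ω).2.2.1) := by
          funext k
          simp only [zItil_apply, nz, Pi.sub_apply, Pi.add_apply, Pi.smul_apply, smul_eq_mul,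
            Fin.snoc_last, Fin.snoc_castSucc]
          ring
        rw [h2]
        refine (nr_le_norm _).trans ?_
        rw [norm_smul, Real.norm_eq_abs, abs_of_nonneg hδ, ← dist_eq_norm, ← hq]
        have h3 := mul_le_mul_of_nonneg_left h1.2.2.1 (show 0 ≤ q * δ by positivity)
        linarith)
      (fun ω => by
        have h1 := hdd T ω
        simp only [Prod.dist_eq, sup_le_iff, Real.dist_eq] at h1
        rw [add_sub_add_left_eq_sub, ← mul_sub, abs_mul, abs_of_nonneg hδ]
        exact mul_le_mul_of_nonneg_left (h1.2.2.2.trans hdq) hδ)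
    have hKl := hlip _ _ _ _ _ _ (C * (δ * (q * d))) (by positivity) hall.1 hall.2.1 hall.2.2
    have hfin : L * (C * (δ * (q * d))) ≤ 1/2 * d := by
      have e1 : δ * (2 * (L * C * q + 1)) ≤ 1 := by
        rwa [le_div_iff₀ (by positivity)] at hδη
      have e2 : δ * (L * C * q) ≤ 1/2 := by nlinarith
      nlinarith
    have hr : (((1/2 : NNReal) : NNReal) : ℝ) * d = 1/2 * d := by norm_num
    rw [hr, Subtype.dist_eq]
    refine (dist_pi_le_iff (by positivity)).2 fun t => (dist_pi_le_iff (by positivity)).2 fun ω => ?_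
    exact (hKl t (Nat.lt_succ_iff.1 t.2) ω).trans hfin
  obtain ⟨g, hg⟩ : ∃ g, Ψ g = g := ⟨_, hΨ.fixedPoint_isFixedPt⟩
  have hgK : ∀ t ≤ T, ∀ ω, extE g.1 t ω = Kop T b f σ h (X g) (Y g) (Z g) t ω := by
    intro t ht ω
    have ht' : t < T + 1 := by omega
    unfold extE
    rw [dif_pos ht']
    have := congrArg (fun s : S => s.1 ⟨t, ht'⟩ ω) hg
    exact this.symm
  obtain ⟨mX, mY, mZ, eX, eY, iX, tY⟩ := hsol g
  beta_reduce at eX eY tY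
  have hnew : IsSolP P W T b f σ h x0 (α + δ) b0 f0 σ0 h0 (X g) (Y g) (Z g) := by
    refine ⟨mX, mY, mZ, ?_, ?_, iX, ?_⟩
    · intro t ht ω
      have h1 := eX t ht ω
      rw [hgK t ht.le ω] at h1
      simp only [Kop, if_pos ht] at h1
      rw [h1]
      rw [dot_M_congr P W t ω _ (fun j => (α + δ) * σ t ω (X g t ω) (Y g t ω) (zItil (Z g t ω)) j +
        (1 - (α + δ)) * (-(Z g t ω j)) + σ0 t ω j)]
      · ring
      · funext k
        simp only [zItil_apply, nz, Pi.add_apply, Pi.smul_apply, smul_eq_mul,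
            Fin.snoc_last, Fin.snoc_castSucc]
        ring
    · intro t ht ω
      have h1 := eY t ht ω
      rw [hgK (t+1) ht ω] at h1
      rw [h1]
      by_cases ht2 : t + 1 < T
      · simp only [Kop, if_pos ht2]
        ring
      · have : t + 1 = T := by omega
        simp only [Kop, this, lt_irrefl, if_false]
        rw [H.fT ω _ _ 0 (zItil (Z g T ω))]
        ring
    · intro ω
      rw [tY ω, hgK T le_rfl ω]
      simp only [Kop, lt_irrefl, if_false]
      ring
  exact ⟨X g, Y g, Z g, hnew, fun X' Y' Z' hs' => uniq hc1 hc2 hT H κ hκ (α + δ) (by linarith)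
    hαδ2 hκαδ x0 b0 f0 σ0 h0 _ _ _ _ _ _ mb0 ms0 hnew hs'⟩

end Helpers

/-- the continuation step — unique solvability propagates by a step
`δ₀` depending only on `c₁`, `c₂` and `T`. -/
theorem stmt17 (c1 c2 : ℝ) (T : ℕ) (hc1 : 0 < c1) (hc2 : 0 < c2) (hT : 1 ≤ T) :
    ∃ δ0 : ℝ, 0 < δ0 ∧ δ0 < 1 ∧
      ∀ (Ω : Type) [Fintype Ω] [DecidableEq Ω] (n : ℕ)
        (P : FinProb Ω) (W : ℕ → Ω → Fin (n + 1)),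
        (∀ t < T, ∀ k ω, 0 < Pt P W t k ω) →
        ∀ (b f : ℕ → Ω → ℝ → ℝ → (Fin n → ℝ) → ℝ)
          (σ : ℕ → Ω → ℝ → ℝ → (Fin n → ℝ) → (Fin (n + 1) → ℝ))
          (h : Ω → ℝ → ℝ) (x0 : ℝ),
          (∀ t x y zi, measF W t (fun ω => b t ω x y zi)) →
          (∀ t x y zi, measF W t (fun ω => σ t ω x y zi)) →
          (∀ t x y zi, measF W t (fun ω => f t ω x y zi)) →
          measF W T h →
          (∀ ω x y zi zi', f T ω x y zi = f T ω x y zi') →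
          (∀ t < T, ∀ ω x y (zi : Fin n → ℝ) x' y' (zi' : Fin n → ℝ),
            |f t ω x y zi - f t ω x' y' zi'| + |b t ω x y zi - b t ω x' y' zi'| +
                nr (Matrix.vecMul (σ t ω x y zi - σ t ω x' y' zi') (EMM P W t ω)) ≤
              c1 * (|x - x'| + |y - y'| + nr (zi - zi'))) →
          (∀ ω x y (zi : Fin n → ℝ) x' y' (zi' : Fin n → ℝ),
            |f T ω x y zi - f T ω x' y' zi'| ≤ c1 * (|x - x'| + |y - y'|)) →
          (∀ ω x x', |h ω x - h ω x'| ≤ c1 * |x - x'|) →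
          (∀ t, 1 ≤ t → t < T → ∀ ω x y x' y' (z z' : Fin (n + 1) → ℝ),
            (-(f t ω x y (zItil z)) + f t ω x' y' (zItil z')) * (x - x') +
                (b t ω x y (zItil z) - b t ω x' y' (zItil z')) * (y - y') +
                dotProduct
                  (Matrix.vecMul (σ t ω x y (zItil z) - σ t ω x' y' (zItil z')) (EMM P W t ω))
                  (z - z') ≤
              -c2 * (|x - x'| + |y - y'| + nr (zItil (z - z'))) ^ 2) →
          (∀ ω x y x' y' (zi zi' : Fin n → ℝ),
            (-(f T ω x y zi) + f T ω x' y' zi') * (x - x') ≤ -c2 * (x - x') ^ 2) →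
          (∀ ω x y x' y' (z z' : Fin (n + 1) → ℝ),
            (b 0 ω x y (zItil z) - b 0 ω x' y' (zItil z')) * (y - y') +
                dotProduct
                  (Matrix.vecMul (σ 0 ω x y (zItil z) - σ 0 ω x' y' (zItil z')) (EMM P W 0 ω))
                  (z - z') ≤
              -c2 * ((y - y') ^ 2 + nr (zItil (z - z')) ^ 2)) →
          (∀ ω x x', (h ω x - h ω x') * (x - x') ≥ c2 * (x - x') ^ 2) →
          ∀ α0 : ℝ, 0 ≤ α0 → α0 < 1 → SolvableAt P W T b f σ h x0 α0 →
            ∀ α : ℝ, α0 ≤ α → α ≤ α0 + δ0 → SolvableAt P W T b f σ h x0 α := by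
  have hmin : 0 < min 1 c2 := lt_min one_pos hc2
  have hmin1 : min 1 c2 ≤ 1 := min_le_left _ _
  have hmin2 : min 1 c2 ≤ c2 := min_le_right _ _
  refine ⟨min 1 c2 / 2, by linarith, by linarith, ?_⟩
  intro Ω _ _ n P W hP b f σ h x0 mb mσ mf mh fT lip lipT liph mon monT mon0 monh α0 hα0 hα01
    hsolv
  have H : Hyp c1 c2 T P W b f σ h :=
    ⟨hP, mb, mσ, mf, mh, fT, lip, lipT, liph, mon, monT, mon0, monh⟩
  set κ := min 1 c2 / 2 with hκd
  have hκ : 0 < κ := by linarith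
  have hκα : ∀ α, 0 ≤ α → α ≤ 1 + κ → κ ≤ α * c2 + 1 - α := by
    intro α h0 h1
    rcases le_total α 1 with h2 | h2
    · nlinarith
    · nlinarith
  obtain ⟨η, hη, hstep⟩ := step hc1 hc2 hT H κ hκ x0
  have key : ∀ k : ℕ, ∀ α, α0 ≤ α → α ≤ α0 + κ → α ≤ α0 + k * η →
      SolvableAt P W T b f σ h x0 α := by
    intro k
    induction k with
    | zero =>
      intro α h1 _ h3
      have : α = α0 := by
        simp at h3
        linarith
      rw [this]
      exact hsolv
    | succ k ih =>
      intro α h1 h2 h3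
      push_cast at h3
      rcases le_total α (α0 + k * η) with h4 | h4
      · exact ih α h1 h2 h4
      · have hk : 0 ≤ k * η := by positivity
        have := hstep (α0 + k * η) (by linarith) (by linarith) (hκα _ (by linarith) (by linarith))
          (ih _ (by linarith) (by linarith) le_rfl) (α - (α0 + k * η)) (by linarith) (by linarith)
          (by linarith)
          (by rw [add_sub_cancel]; exact hκα _ (by linarith) (by linarith))
        rwa [add_sub_cancel] at this
  intro α h1 h2
  obtain ⟨k, hk⟩ := exists_nat_ge (κ / η)
  rw [div_le_iff₀ hη] at hk
  exact key k α h1 h2 (by linarith)
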